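/- Let r ≥ 1. Then: (i) for k = a(PSG_r) and every n, there exists an n-vertex (r,k)-tournament containing no directed tight path on r + r! vertices; and (ii) for k = 1 + a(PSG_r) and every s ≥ 1, there exists n_0 such that for all n ≥ n_0, every n-vertex (r,k)-tournament contains a directed tight path on s vertices. In other words, the minimum k such that the longest tight path guaranteed in n-vertex (r,k)-tournaments tends to infinity with n is exactly 1 + a(PSG_r). -/

import Mathlib

/-- An `(r,k)`-tournament on vertex set `Fin n`: every edge is an injective
`r`-tuple of vertices, and for every `r`-element set of vertices exactly `k`
of its orderings are edges. -/
def IsRKTournament (r k n : ℕ) (E : Set (Fin r → Fin n)) : Prop :=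
  (∀ e ∈ E, Function.Injective e) ∧
  ∀ S : Finset (Fin n), S.card = r →
    {e | e ∈ E ∧ ∀ i, e i ∈ S}.ncard = k

/-- `v` is a directed tight path sequence in the `r`-digraph with edge set `E`:
its entries are distinct and every `r` consecutive entries form an edge. -/
def IsTightPathSeq {r n s : ℕ} (E : Set (Fin r → Fin n)) (v : Fin s → Fin n) : Prop :=
  Function.Injective v ∧
  ∀ j : ℕ, ∀ h : j + r ≤ s,
    (fun i : Fin r => v ⟨j + i.1, by have := i.isLt; omega⟩) ∈ E

/-- The `r`-digraph with edge set `E` contains a directed tight path on `s` vertices. -/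
def HasTightPath (r : ℕ) {n : ℕ} (E : Set (Fin r → Fin n)) (s : ℕ) : Prop :=
  ∃ v : Fin s → Fin n, IsTightPathSeq E v

/-- The adjacency relation of the pattern-shift graph `PSG_r`: permutations of
`Fin r` (written as the tuple of their values), with an edge from `a` to `b`
iff the `(r-1)`-suffix of `a` pattern-matches the `(r-1)`-prefix of `b`. -/
def PSGAdj (r : ℕ) (a b : Equiv.Perm (Fin r)) : Prop :=
  ∀ i j : ℕ, ∀ hi : i + 1 < r, ∀ hj : j + 1 < r,
    (a ⟨i + 1, hi⟩ < a ⟨j + 1, hj⟩ ↔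
      b ⟨i, Nat.lt_of_succ_lt hi⟩ < b ⟨j, Nat.lt_of_succ_lt hj⟩)

/-- `w` is a walk (of size `t`) in the digraph with adjacency `Adj`. -/
def IsWalk {V : Type*} {t : ℕ} (Adj : V → V → Prop) (w : Fin t → V) : Prop :=
  ∀ i : ℕ, ∀ h : i + 1 < t, Adj (w ⟨i, Nat.lt_of_succ_lt h⟩) (w ⟨i + 1, h⟩)

/-- `W_t(G)`: the maximum size of a vertex set whose induced subgraph has no
walk of size `t`. -/
noncomputable def walkFreeMax {V : Type*} [Fintype V] (Adj : V → V → Prop) (t : ℕ) : ℕ :=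
  sSup {m | ∃ S : Finset V, S.card = m ∧
    ¬ ∃ w : Fin t → V, (∀ i, w i ∈ S) ∧ IsWalk Adj w}

/-- `τ_t(G)`: the minimum size of a vertex set intersecting every walk of size `t`. -/
noncomputable def walkTransMin {V : Type*} [Fintype V] (Adj : V → V → Prop) (t : ℕ) : ℕ :=
  sInf {m | ∃ S : Finset V, S.card = m ∧
    ∀ w : Fin t → V, IsWalk Adj w → ∃ i, w i ∈ S}

/-- `a(G)`: the maximum size of a vertex set inducing an acyclic subgraph
(no cycles; a loop is a cycle of size 1). -/
noncomputable def acyclicMax {V : Type*} [Fintype V] (Adj : V → V → Prop) : ℕ :=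
  sSup {m | ∃ S : Finset V, S.card = m ∧
    ¬ ∃ (t : ℕ) (ht : 0 < t) (w : Fin t → V), Function.Injective w ∧
      (∀ i, w i ∈ S) ∧
      ∀ i : Fin t, Adj (w i) (w ⟨(i.1 + 1) % t, Nat.mod_lt _ ht⟩)}

/-- `τ(G)`: the minimum size of a vertex set intersecting every cycle. -/
noncomputable def cycleTransMin {V : Type*} [Fintype V] (Adj : V → V → Prop) : ℕ :=
  sInf {m | ∃ S : Finset V, S.card = m ∧
    ∀ (t : ℕ) (ht : 0 < t) (w : Fin t → V), Function.Injective w →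
      (∀ i : Fin t, Adj (w i) (w ⟨(i.1 + 1) % t, Nat.mod_lt _ ht⟩)) →
      ∃ i, w i ∈ S}

/-- The finite Ramsey theorem for `r`-element subsets and finitely many colours. -/
theorem exists_ramsey_number (C : Type*) [Finite C] (r : ℕ) :
    ∀ m : ℕ, ∃ N : ℕ, ∀ {α : Type} [DecidableEq α] (V : Finset α), N ≤ V.card →
      ∀ f : Finset α → C, ∃ H ⊆ V, H.card = m ∧
        ∃ c, ∀ S ⊆ H, S.card = r → f S = c := by
  classical
  have := Fintype.ofFinite C
  induction r with
  | zero =>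
    refine fun m => ⟨m, fun V hV f => ?_⟩
    obtain ⟨H, hHV, hH⟩ := Finset.exists_subset_card_eq hV
    refine ⟨H, hHV, hH, f ∅, fun S _ hS => ?_⟩
    rw [Finset.card_eq_zero.1 hS]
  | succ r ih =>
    have key : ∀ t : ℕ, ∃ N : ℕ, ∀ {α : Type} [DecidableEq α] (V : Finset α), N ≤ V.card →
        ∀ f : Finset α → C, ∃ H ⊆ V, H.card = t ∧
          ∃ g : α → C, ∀ S ⊆ H, S.card = r + 1 → ∃ v ∈ S, f S = g v := by
      intro t
      induction t with
      | zero =>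
        refine ⟨0, fun V _ f => ⟨∅, by simp, rfl, fun _ => f ∅, fun S hS hc => ?_⟩⟩
        rw [Finset.subset_empty.1 hS] at hc
        simp at hc
      | succ t iht =>
        obtain ⟨N, hN⟩ := iht
        obtain ⟨M, hM⟩ := ih N
        refine ⟨M + 1, fun {α} _ V hV f => ?_⟩
        obtain ⟨v, hv⟩ : V.Nonempty := Finset.card_pos.1 (by omega)
        obtain ⟨W, hWV, hW, c, hc⟩ := hM (V.erase v)
          (by rw [Finset.card_erase_of_mem hv]; omega) (fun S => f (insert v S))
        obtain ⟨H, hHW, hH, g, hg⟩ := hN W hW.ge f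
        have hvH : v ∉ H := fun h => Finset.notMem_erase v V (hWV (hHW h))
        refine ⟨insert v H, Finset.insert_subset hv
          ((hHW.trans hWV).trans (Finset.erase_subset _ _)),
          by rw [Finset.card_insert_of_notMem hvH, hH], Function.update g v c,
          fun S hS hSr => ?_⟩
        by_cases hvS : v ∈ S
        · refine ⟨v, hvS, ?_⟩
          have h := hc (S.erase v) ((Finset.subset_insert_iff.1 hS).trans hHW)
            (by rw [Finset.card_erase_of_mem hvS, hSr]; rfl)
          rw [Finset.insert_erase hvS] at h
          simpa using h
        · have hSH : S ⊆ H := (Finset.subset_insert_iff_of_notMem hvS).1 hS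
          obtain ⟨u, hu, hfu⟩ := hg S hSH hSr
          refine ⟨u, hu, ?_⟩
          rw [hfu, Function.update_of_ne]
          rintro rfl
          exact hvS hu
    intro m
    obtain ⟨N, hN⟩ := key (Fintype.card C * m + 1)
    refine ⟨N, fun V hV f => ?_⟩
    obtain ⟨H, hHV, hH, g, hg⟩ := hN V hV f
    have : Nonempty C := ⟨f ∅⟩
    obtain ⟨c, -, hc⟩ := Finset.exists_le_card_fiber_of_mul_le_card_of_maps_to
      (s := H) (t := Finset.univ) (f := g) (n := m) (fun _ _ => Finset.mem_univ _)
      Finset.univ_nonempty (by rw [hH, Finset.card_univ]; omega)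
    obtain ⟨K, hK, hKm⟩ := Finset.exists_subset_card_eq hc
    refine ⟨K, (hK.trans (Finset.filter_subset _ _)).trans hHV, hKm, c, fun S hS hSr => ?_⟩
    obtain ⟨v, hv, hfv⟩ := hg S ((hS.trans hK).trans (Finset.filter_subset _ _)) hSr
    rw [hfv]
    exact (Finset.mem_filter.1 (hK (hS hv))).2

/-- A vertex set contains a cycle of the digraph `Adj`. -/
def ContainsCycle {V : Type*} (Adj : V → V → Prop) (S : Finset V) : Prop :=
  ∃ (t : ℕ) (ht : 0 < t) (w : Fin t → V), Function.Injective w ∧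
    (∀ i, w i ∈ S) ∧
    ∀ i : Fin t, Adj (w i) (w ⟨(i.1 + 1) % t, Nat.mod_lt _ ht⟩)

theorem bddAbove_card_acyclic {V : Type*} [Fintype V] (Adj : V → V → Prop) :
    BddAbove {m | ∃ S : Finset V, S.card = m ∧ ¬ ContainsCycle Adj S} := by
  refine ⟨Fintype.card V, ?_⟩
  rintro _ ⟨S, rfl, -⟩
  exact S.card_le_univ

theorem exists_acyclic_card_eq_acyclicMax {V : Type*} [Fintype V] (Adj : V → V → Prop) :
    ∃ S : Finset V, S.card = acyclicMax Adj ∧ ¬ ContainsCycle Adj S := by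
  refine Nat.sSup_mem (s := {m | ∃ S : Finset V, S.card = m ∧ ¬ ContainsCycle Adj S})
    ⟨0, ∅, rfl, ?_⟩ (bddAbove_card_acyclic Adj)
  rintro ⟨t, ht, w, -, hw, -⟩
  exact Finset.notMem_empty _ (hw ⟨0, ht⟩)

theorem containsCycle_of_acyclicMax_lt_card {V : Type*} [Fintype V] {Adj : V → V → Prop}
    {S : Finset V} (hS : acyclicMax Adj < S.card) : ContainsCycle Adj S := by
  by_contra h
  exact hS.not_ge (le_csSup (bddAbove_card_acyclic Adj) ⟨S, rfl, h⟩)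

/-- A cycle can be unrolled to an infinite walk. -/
theorem ContainsCycle.exists_walk {V : Type*} {Adj : V → V → Prop} {S : Finset V}
    (h : ContainsCycle Adj S) : ∃ p : ℕ → V, (∀ i, p i ∈ S) ∧ ∀ i, Adj (p i) (p (i + 1)) := by
  obtain ⟨t, ht, w, -, hS, hw⟩ := h
  refine ⟨fun i => w ⟨i % t, Nat.mod_lt _ ht⟩, fun i => hS _, fun i => ?_⟩
  have h := hw ⟨i % t, Nat.mod_lt _ ht⟩
  simpa only [Nat.mod_add_mod] using h

/-- A walk with more steps than there are vertices runs through a cycle. -/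
theorem containsCycle_of_walk {V : Type*} [Fintype V] {Adj : V → V → Prop} {S : Finset V}
    (p : ℕ → V) (hS : ∀ i ≤ Fintype.card V, p i ∈ S)
    (hp : ∀ i < Fintype.card V, Adj (p i) (p (i + 1))) : ContainsCycle Adj S := by
  classical
  have hex : ∃ d, 0 < d ∧ ∃ a, a + d ≤ Fintype.card V ∧ p a = p (a + d) := by
    obtain ⟨x, y, hxy, he⟩ := Fintype.exists_ne_map_eq_of_card_lt
      (fun i : Fin (Fintype.card V + 1) => p i) (by simp)
    rcases lt_or_gt_of_ne hxy with h | h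
    · refine ⟨y.1 - x.1, by omega, x.1, by omega, ?_⟩
      rw [show x.1 + (y.1 - x.1) = y.1 by omega]
      exact he
    · refine ⟨x.1 - y.1, by omega, y.1, by omega, ?_⟩
      rw [show y.1 + (x.1 - y.1) = x.1 by omega]
      exact he.symm
  obtain ⟨hd, a, had, hpa⟩ := Nat.find_spec hex
  have hmin := fun m => Nat.find_min hex (m := m)
  generalize Nat.find hex = d at *
  have hlt : ∀ i j : Fin d, i < j → p (a + i) ≠ p (a + j) := fun i j hij he =>
    hmin (j.1 - i.1) (by omega) ⟨by omega, a + i, by omega, by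
      rw [he]; congr 1; omega⟩
  refine ⟨d, hd, fun i => p (a + i), fun i j he => ?_, fun i => hS _ (by omega), fun i => ?_⟩
  · by_contra hij
    rcases lt_or_gt_of_ne hij with h | h
    · exact hlt i j h he
    · exact hlt j i h he.symm
  · have h := hp (a + i) (by omega)
    rcases Nat.lt_or_ge (i.1 + 1) d with hi | hi
    · simpa only [Nat.mod_eq_of_lt hi, add_assoc] using h
    · have hid : i.1 + 1 = d := by omega
      rw [add_assoc, hid, ← hpa] at h
      simpa only [hid, Nat.mod_self, add_zero] using h

/-- A permutation of `A` presented as an injective tuple is the increasing enumeration of `A`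
composed with a permutation of the indices. -/
theorem exists_orderEmbOfFin_comp_eq {α : Type*} [LinearOrder α] {r : ℕ} {A : Finset α}
    (hA : A.card = r) {e : Fin r → α} (he : Function.Injective e) (heA : ∀ i, e i ∈ A) :
    ∃ σ : Equiv.Perm (Fin r), A.orderEmbOfFin hA ∘ σ = e := by
  let g : Fin r → Fin r := fun i => (A.orderIsoOfFin hA).symm ⟨e i, heA i⟩
  have hg : Function.Injective g := fun i j hij =>
    he (congrArg Subtype.val ((A.orderIsoOfFin hA).symm.injective hij))
  refine ⟨Equiv.ofBijective g (Finite.injective_iff_bijective.1 hg), funext fun i => ?_⟩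
  simp [g, ← Finset.coe_orderIsoOfFin_apply]

theorem orderEmbOfFin_comp_eq_of_pattern {α : Type*} [LinearOrder α] {r : ℕ} {A : Finset α}
    (hA : A.card = r) {e : Fin r → α} (heA : ∀ i, e i ∈ A) {σ : Equiv.Perm (Fin r)}
    (hσ : ∀ i j, σ i < σ j ↔ e i < e j) : A.orderEmbOfFin hA ∘ σ = e := by
  have h := Finset.orderEmbOfFin_unique hA (f := e ∘ σ.symm) (fun i => heA _)
    (fun i j hij => (hσ _ _).1 (by simpa using hij))
  rw [← h]
  funext i
  simp

theorem exists_between_finsets_notMem {α : Type*} [LinearOrder α] [DenselyOrdered α]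
    [NoMinOrder α] [NoMaxOrder α] [Nonempty α] (lo hi F : Finset α)
    (h : ∀ x ∈ lo, ∀ y ∈ hi, x < y) :
    ∃ z, z ∉ F ∧ (∀ x ∈ lo, x < z) ∧ ∀ y ∈ hi, z < y := by
  classical
  obtain ⟨m, hlo, hhi⟩ := Order.exists_between_finsets lo hi h
  obtain ⟨z, hz, hz'⟩ := Order.exists_between_finsets {m} (hi ∪ F.filter (m < ·)) (by
    intro x hx y hy
    rw [Finset.mem_singleton.1 hx]
    rcases Finset.mem_union.1 hy with hy | hy
    · exact hhi y hy
    · exact (Finset.mem_filter.1 hy).2)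
  have hmz := hz m (Finset.mem_singleton_self m)
  refine ⟨z, fun hzF => ?_, fun x hx => (hlo x hx).trans hmz,
    fun y hy => hz' y (Finset.mem_union_left _ hy)⟩
  exact lt_irrefl z (hz' z (Finset.mem_union_right _ (Finset.mem_filter.2 ⟨hzF, hmz⟩)))

/-- Every walk in the pattern-shift graph is the sequence of patterns of the windows of
a sequence of distinct rationals. -/
theorem exists_seq_of_psg_walk {r : ℕ} (hr : 1 ≤ r) (p : ℕ → Equiv.Perm (Fin r))
    (hp : ∀ i, PSGAdj r (p i) (p (i + 1))) (t : ℕ) :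
    ∃ x : ℕ → ℚ, Set.InjOn x (Set.Iio (r + t)) ∧
      ∀ j ≤ t, ∀ i i' : Fin r, p j i < p j i' ↔ x (j + i) < x (j + i') := by
  classical
  induction t with
  | zero =>
    refine ⟨fun i => if h : i < r then ((p 0 ⟨i, h⟩ : ℕ) : ℚ) else 0, ?_, ?_⟩
    · intro i hi j hj hij
      simp only [Set.mem_Iio, add_zero] at hi hj
      simpa [hi, hj, Fin.val_inj] using hij
    · rintro j hj i i'
      obtain rfl : j = 0 := by omega
      simp
  | succ t ih =>
    obtain ⟨x, hx, hxp⟩ := ih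
    let q := p (t + 1)
    let l : Fin r := ⟨r - 1, by omega⟩
    have hold : ∀ i i' : Fin r, i.1 + 1 < r → i'.1 + 1 < r →
        (q i < q i' ↔ x (t + 1 + i) < x (t + 1 + i')) := fun i i' hi hi' => by
      have h1 := hp t i i' hi hi'
      have h2 := hxp t le_rfl ⟨i + 1, hi⟩ ⟨i' + 1, hi'⟩
      simp only [show t + (i.1 + 1) = t + 1 + i by omega,
        show t + (i'.1 + 1) = t + 1 + i' by omega] at h2
      exact h1.symm.trans h2
    obtain ⟨z, hzF, hlo, hhi⟩ := exists_between_finsets_notMem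
      ((Finset.univ.filter fun i : Fin r => q i < q l : Finset (Fin r)).image fun i : Fin r => x (t + 1 + i.1))
      ((Finset.univ.filter fun i : Fin r => q l < q i : Finset (Fin r)).image fun i : Fin r => x (t + 1 + i.1))
      ((Finset.range (r + t)).image x) (by
        simp only [Finset.mem_image, Finset.mem_filter, Finset.mem_univ, true_and]
        rintro _ ⟨i, hi, rfl⟩ _ ⟨i', hi', rfl⟩
        have h1 : i ≠ l := fun h => lt_irrefl _ (h ▸ hi)
        have h2 : i' ≠ l := fun h => lt_irrefl _ (h ▸ hi')
        have h3 : i.1 ≠ r - 1 := fun h => h1 (Fin.ext h)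
        have h4 : i'.1 ≠ r - 1 := fun h => h2 (Fin.ext h)
        exact (hold i i' (by omega) (by omega)).1 (hi.trans hi'))
    simp only [Finset.mem_image, Finset.mem_filter, Finset.mem_univ, true_and, Finset.mem_range,
      not_exists, not_and, forall_exists_index, and_imp, forall_apply_eq_imp_iff₂] at hzF hlo hhi
    refine ⟨Function.update x (r + t) z, ?_, ?_⟩
    · intro i hi j hj hij
      simp only [Set.mem_Iio] at hi hj
      by_cases h1 : i = r + t <;> by_cases h2 : j = r + t
      · omega
      · subst h1
        rw [Function.update_self, Function.update_of_ne h2] at hij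
        exact absurd hij.symm (hzF j (by omega))
      · subst h2
        rw [Function.update_self, Function.update_of_ne h1] at hij
        exact absurd hij (hzF i (by omega))
      · rw [Function.update_of_ne h1, Function.update_of_ne h2] at hij
        exact hx (by simp only [Set.mem_Iio]; omega) (by simp only [Set.mem_Iio]; omega) hij
    · intro j hj i i'
      rcases Nat.lt_or_ge j (t + 1) with hjt | hjt
      · rw [Function.update_of_ne (by omega), Function.update_of_ne (by omega)]
        exact hxp j (by omega) i i'
      · obtain rfl : j = t + 1 := by omega
        have hlast : ∀ i : Fin r, ¬ i.1 + 1 < r → i = l ∧ t + 1 + i.1 = r + t := fun i hi =>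
          ⟨Fin.ext (show i.1 = r - 1 by omega), by omega⟩
        by_cases h1 : i.1 + 1 < r <;> by_cases h2 : i'.1 + 1 < r
        · rw [Function.update_of_ne (by omega), Function.update_of_ne (by omega)]
          exact hold i i' h1 h2
        · obtain ⟨rfl, h3⟩ := hlast i' h2
          rw [h3, Function.update_self, Function.update_of_ne (by omega)]
          refine ⟨hlo i, fun h => ?_⟩
          by_contra hn
          have hne : q i ≠ q l := fun he => by
            have := congrArg Fin.val (q.injective he)
            omega
          exact lt_asymm h (hhi i (lt_of_le_of_ne (not_lt.1 hn) hne.symm))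
        · obtain ⟨rfl, h3⟩ := hlast i h1
          rw [h3, Function.update_self, Function.update_of_ne (by omega)]
          refine ⟨hhi i', fun h => ?_⟩
          by_contra hn
          have hne : q i' ≠ q l := fun he => by
            have := congrArg Fin.val (q.injective he)
            omega
          exact lt_asymm h (hlo i' (lt_of_le_of_ne (not_lt.1 hn) hne))
        · rw [(hlast i h1).1, (hlast i' h2).1]
          simp

/-- The tuples in `Fin n` whose pattern lies in `S`. -/
def patternEdges {r : ℕ} (n : ℕ) (S : Finset (Equiv.Perm (Fin r))) : Set (Fin r → Fin n) :=
  {e | ∃ σ ∈ S, ∃ φ : Fin r ↪o Fin n, e = φ ∘ σ}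

theorem injective_orderEmb_comp {α : Type*} [LinearOrder α] {r : ℕ} (φ : Fin r ↪o α) :
    Function.Injective fun σ : Equiv.Perm (Fin r) => φ ∘ σ := fun _ _ h =>
  Equiv.ext fun i => φ.injective (congrFun h i)

theorem isRKTournament_patternEdges {r : ℕ} (n : ℕ) (S : Finset (Equiv.Perm (Fin r))) :
    IsRKTournament r S.card n (patternEdges n S) := by
  refine ⟨?_, fun A hA => ?_⟩
  · rintro _ ⟨σ, -, φ, rfl⟩
    exact φ.injective.comp σ.injective
  · have : {e | e ∈ patternEdges n S ∧ ∀ i, e i ∈ A} =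
        (fun σ : Equiv.Perm (Fin r) => A.orderEmbOfFin hA ∘ σ) '' S := by
      ext e
      constructor
      · rintro ⟨⟨σ, hσ, φ, rfl⟩, he⟩
        exact ⟨σ, hσ, orderEmbOfFin_comp_eq_of_pattern hA he fun i j => φ.lt_iff_lt.symm⟩
      · rintro ⟨σ, hσ, rfl⟩
        exact ⟨⟨σ, hσ, _, rfl⟩, fun i => A.orderEmbOfFin_mem hA _⟩
    rw [this, Set.ncard_image_of_injective _ (injective_orderEmb_comp _), Set.ncard_coe_finset]

theorem not_hasTightPath_patternEdges {r : ℕ} (n : ℕ) {S : Finset (Equiv.Perm (Fin r))}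
    (hS : ¬ ContainsCycle (PSGAdj r) S) :
    ¬ HasTightPath r (patternEdges n S) (r + r.factorial) := by
  rintro ⟨v, -, hv⟩
  have hwin : ∀ j : ℕ, ∃ σ : Equiv.Perm (Fin r), ∀ h : j + r ≤ r + r.factorial, σ ∈ S ∧
      ∀ i i' : Fin r, σ i < σ i' ↔ v ⟨j + i, by omega⟩ < v ⟨j + i', by omega⟩ := by
    intro j
    by_cases h : j + r ≤ r + r.factorial
    · obtain ⟨σ, hσ, φ, he⟩ := hv j h
      refine ⟨σ, fun _ => ⟨hσ, fun i i' => ?_⟩⟩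
      rw [← φ.lt_iff_lt]
      have h1 := congrFun he i
      have h2 := congrFun he i'
      simp only [Function.comp_apply] at h1 h2
      rw [h1, h2]
    · exact ⟨1, fun h' => absurd h' h⟩
  choose p hp using hwin
  have hcard : Fintype.card (Equiv.Perm (Fin r)) = r.factorial := by
    rw [Fintype.card_perm, Fintype.card_fin]
  refine hS (containsCycle_of_walk p (fun i hi => (hp i (by omega)).1) fun j hj => ?_)
  intro i i' hi hi'
  have h1 := (hp j (by omega)).2 ⟨i + 1, hi⟩ ⟨i' + 1, hi'⟩
  have h2 := (hp (j + 1) (by omega)).2 ⟨i, by omega⟩ ⟨i', by omega⟩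
  simp only [show j + (i + 1) = j + 1 + i by omega,
    show j + (i' + 1) = j + 1 + i' by omega] at h1
  exact h1.trans h2.symm

/-- The patterns of the edges of `E` inside `A`. -/
def edgePatterns {r n : ℕ} (E : Set (Fin r → Fin n)) (A : Finset (Fin n)) :
    Set (Equiv.Perm (Fin r)) :=
  {σ | ∃ hA : A.card = r, A.orderEmbOfFin hA ∘ σ ∈ E}

theorem IsRKTournament.ncard_edgePatterns {r k n : ℕ} {E : Set (Fin r → Fin n)}
    (hE : IsRKTournament r k n E) {A : Finset (Fin n)} (hA : A.card = r) :
    (edgePatterns E A).ncard = k := by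
  rw [← hE.2 A hA, ← Set.ncard_image_of_injective _
    (injective_orderEmb_comp (A.orderEmbOfFin hA))]
  congr 1
  ext e
  constructor
  · rintro ⟨σ, ⟨_, hσ⟩, rfl⟩
    exact ⟨hσ, fun i => A.orderEmbOfFin_mem hA _⟩
  · rintro ⟨he, heA⟩
    obtain ⟨σ, rfl⟩ := exists_orderEmbOfFin_comp_eq hA (hE.1 e he) heA
    exact ⟨σ, ⟨hA, he⟩, rfl⟩

/-- If all `r`-subsets of `H` have the same edge patterns and these contain a cycle of the
pattern-shift graph, then there is a tight path in `H`. -/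
theorem hasTightPath_of_homogeneous {r n s : ℕ} (hr : 1 ≤ r) {E : Set (Fin r → Fin n)}
    {H : Finset (Fin n)} (hH : H.card = r + s) {T : Finset (Equiv.Perm (Fin r))}
    (hT : ∀ A ⊆ H, A.card = r → edgePatterns E A = T) (hc : ContainsCycle (PSGAdj r) T) :
    HasTightPath r E s := by
  classical
  obtain ⟨p, hpT, hp⟩ := hc.exists_walk
  obtain ⟨x, hx, hxp⟩ := exists_seq_of_psg_walk hr p hp s
  have hX : ((Finset.range (r + s)).image x).card = r + s := by
    rw [Finset.card_image_of_injOn (by simpa using hx), Finset.card_range]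
  let ι := (((Finset.range (r + s)).image x).orderIsoOfFin hX).symm
  let v : Fin s → Fin n := fun i => H.orderEmbOfFin hH
    (ι ⟨x i, Finset.mem_image_of_mem x (Finset.mem_range.2 (by omega))⟩)
  have hv : ∀ i j, v i < v j ↔ x i < x j := fun i j => by simp [v]
  have hinj : Function.Injective v := fun i j hij => by
    have h := ι.injective ((H.orderEmbOfFin hH).injective hij)
    exact Fin.ext (hx (by simp only [Set.mem_Iio]; omega) (by simp only [Set.mem_Iio]; omega)
      (congrArg Subtype.val h))
  refine ⟨v, hinj, fun j hj => ?_⟩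
  set e : Fin r → Fin n := fun i => v ⟨j + i, by omega⟩
  have heinj : Function.Injective e := fun a b hab => by
    have := congrArg Fin.val (hinj hab)
    exact Fin.ext (by simpa using this)
  have hA : (Finset.univ.image e).card = r := by
    rw [Finset.card_image_of_injective _ heinj, Finset.card_fin]
  have hAH : Finset.univ.image e ⊆ H := by
    intro a ha
    obtain ⟨i, -, rfl⟩ := Finset.mem_image.1 ha
    exact H.orderEmbOfFin_mem hH _
  have hmem : p j ∈ edgePatterns E (Finset.univ.image e) := by
    rw [hT _ hAH hA]
    exact hpT j
  obtain ⟨_, hmem⟩ := hmem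
  rwa [orderEmbOfFin_comp_eq_of_pattern hA (fun i => Finset.mem_image_of_mem e (Finset.mem_univ i))
    fun i i' => (hxp j (by omega) i i').trans (hv ⟨j + i, by omega⟩ ⟨j + i', by omega⟩).symm]
    at hmem

/-- Theorem: the growing-path threshold for `(r,k)`-tournaments is exactly
`1 + a(PSG_r)`: with `k = a(PSG_r)` there are arbitrarily large tournaments
with no tight path on `r + r!` vertices, while with `k = 1 + a(PSG_r)` every
sufficiently large tournament contains a tight path on `s` vertices, for each `s`. -/
theorem stmt5 (r : ℕ) (hr : 1 ≤ r) :
    (∀ n : ℕ, ∃ E : Set (Fin r → Fin n),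
      IsRKTournament r (acyclicMax (PSGAdj r)) n E ∧
      ¬ HasTightPath r E (r + r.factorial)) ∧
    (∀ s : ℕ, 1 ≤ s → ∃ n₀ : ℕ, ∀ n : ℕ, n₀ ≤ n →
      ∀ E : Set (Fin r → Fin n),
        IsRKTournament r (1 + acyclicMax (PSGAdj r)) n E →
        HasTightPath r E s) := by
  classical
  constructor
  · intro n
    obtain ⟨S, hS, hac⟩ := exists_acyclic_card_eq_acyclicMax (PSGAdj r)
    exact ⟨patternEdges n S, hS ▸ isRKTournament_patternEdges n S,
      not_hasTightPath_patternEdges n hac⟩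
  · intro s _
    obtain ⟨N, hN⟩ := exists_ramsey_number (Set (Equiv.Perm (Fin r))) r (r + s)
    refine ⟨N, fun n hn E hE => ?_⟩
    obtain ⟨H, -, hH, T, hT⟩ := hN (Finset.univ : Finset (Fin n)) (by simpa using hn)
      (edgePatterns E)
    refine hasTightPath_of_homogeneous hr hH (T := T.toFinset)
      (fun A hAH hA => by rw [hT A hAH hA, Set.coe_toFinset])
      (containsCycle_of_acyclicMax_lt_card ?_)
    obtain ⟨A, hAH, hA⟩ := Finset.exists_subset_card_eq (show r ≤ H.card by omega)
    have h := hE.ncard_edgePatterns hA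
    rw [hT A hAH hA, Set.ncard_eq_toFinset_card'] at h
    omega
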